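/- arXiv:2101.04967 — 3 statements merged into one kernel-verified Lean document; each statement's English description precedes it below -/
import Mathlib

section
/- Every strictly uniform topological dynamical system is continuously strictly pointwise ergodic. -/
open MeasureTheory Filter Topology Metric

section TopDefs

variable {X : Type*} [MetricSpace X]

/-- The Cesàro (Birkhoff) averages `(1/n) ∑_{i<n} f(Tⁱ x)`. -/
noncomputable def cesaro (T : X → X) (f : X → ℝ) (n : ℕ) (x : X) : ℝ :=
  (n : ℝ)⁻¹ * ∑ i ∈ Finset.range n, f (T^[i] x)

/-- `P` is a partition of `X` (into nonempty sets, every point in exactly one atom). -/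
def IsPartition (P : Set (Set X)) : Prop :=
  (∀ A ∈ P, A.Nonempty) ∧ ∀ x : X, ∃! A : Set X, A ∈ P ∧ x ∈ A

/-- A partition is upper semicontinuous if whenever a sequence of atoms converges in the
Hausdorff metric to a (nonempty compact) set `S`, then `S` is contained in some atom. -/
def PartitionUSC (P : Set (Set X)) : Prop :=
  ∀ A : ℕ → Set X, (∀ n, A n ∈ P) → ∀ S : Set X, S.Nonempty → IsCompact S →
    Tendsto (fun n => hausdorffDist (A n) S) atTop (𝓝 0) → ∃ B ∈ P, S ⊆ B

/-- A partition is lower semicontinuous if whenever a sequence of atoms converges in the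
Hausdorff metric to a (nonempty compact) set `S`, then `S` contains some atom. -/
def PartitionLSC (P : Set (Set X)) : Prop :=
  ∀ A : ℕ → Set X, (∀ n, A n ∈ P) → ∀ S : Set X, S.Nonempty → IsCompact S →
    Tendsto (fun n => hausdorffDist (A n) S) atTop (𝓝 0) → ∃ B ∈ P, B ⊆ S

/-- Upper semicontinuity of a (compact-)set-valued function: if `yₙ → y₀` and
`f(yₙ) → S` in the Hausdorff metric, then `S ⊆ f(y₀)`. -/
def SetValuedUSC {Y : Type*} [MetricSpace Y] (f : Y → Set X) : Prop :=
  ∀ (y : ℕ → Y) (y₀ : Y), Tendsto y atTop (𝓝 y₀) →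
    ∀ S : Set X, S.Nonempty → IsCompact S →
      Tendsto (fun n => hausdorffDist (f (y n)) S) atTop (𝓝 0) → S ⊆ f y₀

/-- Lower semicontinuity of a (compact-)set-valued function: if `yₙ → y₀` and
`f(yₙ) → S` in the Hausdorff metric, then `f(y₀) ⊆ S`. -/
def SetValuedLSC {Y : Type*} [MetricSpace Y] (f : Y → Set X) : Prop :=
  ∀ (y : ℕ → Y) (y₀ : Y), Tendsto y atTop (𝓝 y₀) →
    ∀ S : Set X, S.Nonempty → IsCompact S →
      Tendsto (fun n => hausdorffDist (f (y n)) S) atTop (𝓝 0) → f y₀ ⊆ S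

/-- A set is invariant for the homeomorphism `T` if `T(K) = K`. -/
def IsInvariantSet (T : X ≃ₜ X) (K : Set X) : Prop := T '' K = K

/-- A minimal set: nonempty, closed, invariant, with no proper nonempty closed invariant
subset. -/
def IsMinimalSet (T : X ≃ₜ X) (K : Set X) : Prop :=
  K.Nonempty ∧ IsClosed K ∧ IsInvariantSet T K ∧
    ∀ K' : Set X, K' ⊆ K → K'.Nonempty → IsClosed K' → IsInvariantSet T K' → K' = K

/-- A system is semi-simple if `X` is a union of minimal sets. -/
def SemiSimple (T : X ≃ₜ X) : Prop :=
  ∀ x : X, ∃ K : Set X, IsMinimalSet T K ∧ x ∈ K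

/-- A system is uniform if the Cesàro means of every continuous function converge
uniformly on `X`. -/
def UniformSystem (T : X ≃ₜ X) : Prop :=
  ∀ f : C(X, ℝ), ∃ g : X → ℝ,
    TendstoUniformly (fun n x => cesaro (⇑T) (⇑f) n x) g atTop

/-- Uniformity of the subsystem carried by the set `M`: the Cesàro means of every
continuous function converge uniformly on `M`. -/
def UniformOn (T : X ≃ₜ X) (M : Set X) : Prop :=
  ∀ f : C(X, ℝ), ∃ g : X → ℝ,
    TendstoUniformlyOn (fun n x => cesaro (⇑T) (⇑f) n x) g atTop M

/-- Strictly uniform = uniform + semi-simple. -/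
def StrictlyUniform (T : X ≃ₜ X) : Prop := UniformSystem T ∧ SemiSimple T

end TopDefs

section MeasDefs

variable {X : Type*} [MetricSpace X] [CompactSpace X]
  [MeasurableSpace X] [BorelSpace X]

/-- A `T`-invariant Borel probability measure. -/
def IsInvariantMeasure (T : X ≃ₜ X) (μ : ProbabilityMeasure X) : Prop :=
  μ.toMeasure.map ⇑T = μ.toMeasure

/-- An ergodic `T`-invariant Borel probability measure. -/
def IsErgodicMeasure (T : X ≃ₜ X) (μ : ProbabilityMeasure X) : Prop :=
  Ergodic (⇑T) μ.toMeasure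

/-- `x` is generic for `μ`: the Cesàro means of every continuous function at `x`
converge to the integral of the function against `μ`. -/
def IsGenericFor (T : X ≃ₜ X) (x : X) (μ : ProbabilityMeasure X) : Prop :=
  ∀ f : C(X, ℝ),
    Tendsto (fun n => cesaro (⇑T) (⇑f) n x) atTop (𝓝 (∫ y, f y ∂μ.toMeasure))

/-- Pointwise ergodic: every point is generic for some ergodic measure. -/
def PointwiseErgodic (T : X ≃ₜ X) : Prop :=
  ∀ x : X, ∃ μ : ProbabilityMeasure X, IsErgodicMeasure T μ ∧ IsGenericFor T x μ

/-- The set of points generic for `μ` (a fiber of the map `Φ`). -/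
def genericFiber (T : X ≃ₜ X) (μ : ProbabilityMeasure X) : Set X :=
  {x : X | IsGenericFor T x μ}

/-- The generic-point partition `𝒫`: the (nonempty) fibers of the map `Φ` sending each
point to the ergodic measure it generates. -/
def genericPartition (T : X ≃ₜ X) : Set (Set X) :=
  {A : Set X | ∃ μ : ProbabilityMeasure X, IsErgodicMeasure T μ ∧
    (genericFiber T μ).Nonempty ∧ A = genericFiber T μ}

/-- Continuously pointwise ergodic: every point is generic for an ergodic measure and the
map `Φ` sending each point to that measure is continuous (weak-star topology). -/
def ContinuouslyPointwiseErgodic (T : X ≃ₜ X) : Prop :=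
  ∃ Φ : X → ProbabilityMeasure X, Continuous Φ ∧
    ∀ x : X, IsErgodicMeasure T (Φ x) ∧ IsGenericFor T x (Φ x)

/-- Continuously strictly pointwise ergodic = continuously pointwise ergodic +
semi-simple. -/
def ContinuouslyStrictlyPointwiseErgodic (T : X ≃ₜ X) : Prop :=
  ContinuouslyPointwiseErgodic T ∧ SemiSimple T

/-- The set `K` carries exactly one `T`-invariant Borel probability measure. -/
def UniquelyErgodicOn (T : X ≃ₜ X) (K : Set X) : Prop :=
  ∃! μ : ProbabilityMeasure X, IsInvariantMeasure T μ ∧ μ.toMeasure K = 1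

/-- Partitionable: `X` is a disjoint union of closed invariant uniquely ergodic sets. -/
def Partitionable (T : X ≃ₜ X) : Prop :=
  ∃ P : Set (Set X), IsPartition P ∧
    ∀ K ∈ P, IsClosed K ∧ IsInvariantSet T K ∧ UniquelyErgodicOn T K

/-- Strictly partitionable: `X` is a union of strictly ergodic (minimal and uniquely
ergodic) subsystems. -/
def StrictlyPartitionable (T : X ≃ₜ X) : Prop :=
  ∀ x : X, ∃ K : Set X, x ∈ K ∧ IsMinimalSet T K ∧ UniquelyErgodicOn T K

/-- The topological support of a measure: points all of whose open neighborhoods have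
positive measure (equivalently, the smallest closed set of full measure). -/
def msupp (μ : ProbabilityMeasure X) : Set X :=
  {x : X | ∀ U : Set X, IsOpen U → x ∈ U → 0 < μ.toMeasure U}

/-- The set `ℳ_T^e(X)` of ergodic invariant probability measures. -/
def ErgodicSet (T : X ≃ₜ X) : Set (ProbabilityMeasure X) :=
  {μ : ProbabilityMeasure X | IsErgodicMeasure T μ}

/-- Continuity of the set-valued map `supp : ℳ_T^e(X) → 2^X` (sequentially, via the
Hausdorff metric; `ℳ_T^e(X)` carries the weak-star topology, which is metrizable). -/
def SuppContinuousOnErgodic (T : X ≃ₜ X) : Prop :=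
  ∀ μ ∈ ErgodicSet T, ∀ ν : ℕ → ProbabilityMeasure X,
    (∀ n, ν n ∈ ErgodicSet T) → Tendsto ν atTop (𝓝 μ) →
    Tendsto (fun n => hausdorffDist (msupp (ν n)) (msupp μ)) atTop (𝓝 0)

end MeasDefs
section Proof11

variable {X : Type*} [MetricSpace X] [CompactSpace X]

lemma s11_cesaro_eq (T : X → X) (f : X → ℝ) (n : ℕ) (x : X) :
    cesaro T f n x = birkhoffAverage ℝ T f n x := rfl

lemma s11_cesaro_cont (T : X ≃ₜ X) (f : C(X, ℝ)) (n : ℕ) :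
    Continuous (fun x => cesaro T f n x) := by
  unfold cesaro
  refine continuous_const.mul (continuous_finsetSum _ fun i _ => ?_)
  exact f.continuous.comp (T.continuous.iterate i)

lemma s11_cesaro_bound (T : X ≃ₜ X) (f : C(X, ℝ)) (n : ℕ) (x : X) :
    ‖cesaro T f n x‖ ≤ ‖f‖ := by
  unfold cesaro
  rcases Nat.eq_zero_or_pos n with rfl | hn
  · simp
  have hn' : (0 : ℝ) < n := by exact_mod_cast hn
  have h1 : ‖∑ i ∈ Finset.range n, f (T^[i] x)‖ ≤ n * ‖f‖ := by
    refine (norm_sum_le_of_le _ (fun i _ => f.norm_coe_le_norm _)).trans ?_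
    simp
  rw [norm_mul, norm_inv, Real.norm_of_nonneg hn'.le, inv_mul_le_iff₀ hn']
  exact h1

lemma s11_inv (T : X ≃ₜ X) (f : C(X, ℝ)) (g : X → ℝ)
    (hg : ∀ x, Tendsto (fun n => cesaro T f n x) atTop (𝓝 (g x))) (x : X) :
    g (T x) = g x := by
  have h := tendsto_birkhoffAverage_apply_sub_birkhoffAverage' ℝ (f := ⇑T) (g := ⇑f)
    (isCompact_range f.continuous).isBounded x
  have h2 := (hg (T x)).sub (hg x)
  have := tendsto_nhds_unique h h2
  linarith

lemma s11_const (T : X ≃ₜ X) (g : X → ℝ) (hc : Continuous g) (hi : ∀ x, g (T x) = g x)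
    (K : Set X) (hK : IsMinimalSet T K) (x : X) (hx : x ∈ K) (y : X) (hy : y ∈ K) :
    g y = g x := by
  obtain ⟨-, hcl, hinv, hmin⟩ := hK
  have h := hmin (K ∩ g ⁻¹' {g x}) Set.inter_subset_left ⟨x, hx, rfl⟩
    (hcl.inter (isClosed_singleton.preimage hc)) ?_
  · have : y ∈ K ∩ g ⁻¹' {g x} := by rw [h]; exact hy
    exact this.2
  · unfold IsInvariantSet at *
    ext z
    constructor
    · rintro ⟨w, ⟨hw, hgw⟩, rfl⟩
      refine ⟨hinv ▸ ⟨w, hw, rfl⟩, ?_⟩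
      simpa [hi] using hgw
    · rintro ⟨hz, hgz⟩
      rw [← hinv] at hz
      obtain ⟨w, hw, rfl⟩ := hz
      refine ⟨w, ⟨hw, ?_⟩, rfl⟩
      simpa [hi] using hgz

variable [MeasurableSpace X] [BorelSpace X]

lemma s11_riesz (T : X ≃ₜ X) (L : C(X, ℝ) → ℝ) (x : X)
    (hL : ∀ f : C(X, ℝ), Tendsto (fun n => cesaro T f n x) atTop (𝓝 (L f))) :
    ∃ μ : ProbabilityMeasure X, ∀ f : C(X, ℝ), ∫ y, f y ∂μ.toMeasure = L f := by
  let A : CompactlySupportedContinuousMap X ℝ →ₗ[ℝ] ℝ :=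
    { toFun := fun f => L f.toContinuousMap
      map_add' := fun f g => by
        refine tendsto_nhds_unique (hL _) (((hL f.toContinuousMap).add
          (hL g.toContinuousMap)).congr fun n => ?_)
        simp [cesaro, Finset.sum_add_distrib, mul_add]
      map_smul' := fun c f => by
        refine tendsto_nhds_unique (hL _) (((hL f.toContinuousMap).const_mul c).congr
          fun n => ?_)
        simp [cesaro, Finset.mul_sum, mul_left_comm] }
  let Λ : CompactlySupportedContinuousMap X ℝ →ₚ[ℝ] ℝ := PositiveLinearMap.mk₀ A (by
    intro f hf
    refine ge_of_tendsto' (hL f.toContinuousMap) fun n => ?_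
    exact mul_nonneg (by positivity) (Finset.sum_nonneg fun i _ => hf _))
  have hint : ∀ f : C(X, ℝ), ∫ y, f y ∂(RealRMK.rieszMeasure Λ) = L f := fun f =>
    RealRMK.integral_rieszMeasure Λ (CompactlySupportedContinuousMap.continuousMapEquiv f)
  have h1 : L 1 = 1 := by
    refine tendsto_nhds_unique (hL 1) (tendsto_const_nhds.congr' ?_)
    filter_upwards [eventually_gt_atTop 0] with n hn
    have : (n : ℝ) ≠ 0 := by exact_mod_cast hn.ne'
    simp [cesaro, this]
  have hp : IsProbabilityMeasure (RealRMK.rieszMeasure Λ) := by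
    have := hint 1
    rw [h1] at this
    simp [measureReal_def] at this
    constructor
    rwa [ENNReal.toReal_eq_one_iff] at this
  exact ⟨⟨_, hp⟩, hint⟩

lemma s11_integral_cesaro (T : X ≃ₜ X) (ν : Measure X) [IsFiniteMeasure ν]
    (hν : MeasurePreserving T ν ν) (f : C(X, ℝ)) (n : ℕ) (hn : 0 < n) :
    ∫ y, cesaro T f n y ∂ν = ∫ y, f y ∂ν := by
  have hn' : (n : ℝ) ≠ 0 := by exact_mod_cast hn.ne'
  unfold cesaro
  rw [integral_const_mul, integral_finsetSum]
  · have : ∀ i ∈ Finset.range n, ∫ y, f (T^[i] y) ∂ν = ∫ y, f y ∂ν := by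
      intro i _
      have hi := hν.iterate i
      have h2 := integral_map (μ := ν) hi.measurable.aemeasurable
        (f := f) f.continuous.aestronglyMeasurable
      rw [hi.map_eq] at h2
      exact h2.symm
    rw [Finset.sum_congr rfl this]
    simp [hn']
  · intro i _
    exact (f.continuous.comp (T.continuous.iterate i)).integrable_of_hasCompactSupport
      (HasCompactSupport.of_compactSpace _)

lemma s11_integral_lim (T : X ≃ₜ X) (ν : Measure X) [IsFiniteMeasure ν]
    (hν : MeasurePreserving T ν ν) (f : C(X, ℝ)) (g : X → ℝ)
    (hg : ∀ x, Tendsto (fun n => cesaro T f n x) atTop (𝓝 (g x))) :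
    ∫ y, f y ∂ν = ∫ y, g y ∂ν := by
  have h := tendsto_integral_of_dominated_convergence (μ := ν) (fun _ => ‖f‖)
    (fun n => (s11_cesaro_cont T f n).aestronglyMeasurable) (integrable_const _)
    (fun n => ae_of_all _ (s11_cesaro_bound T f n)) (ae_of_all _ hg)
  refine tendsto_nhds_unique (tendsto_const_nhds.congr' ?_) h
  filter_upwards [eventually_gt_atTop 0] with n hn
  exact (s11_integral_cesaro T ν hν f n hn).symm

lemma s11_ext (μ ν : Measure X) [IsFiniteMeasure μ] [IsFiniteMeasure ν]
    (h : ∀ f : C(X, ℝ), ∫ x, f x ∂μ = ∫ x, f x ∂ν) : μ = ν :=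
  ext_of_forall_integral_eq_of_IsFiniteMeasure fun f => h f.toContinuousMap

lemma s11_ergodic (T : X ≃ₜ X) (L : C(X, ℝ) → X → ℝ) (hc : ∀ f, Continuous (L f))
    (hL : ∀ (f : C(X, ℝ)) (x : X), Tendsto (fun n => cesaro T f n x) atTop (𝓝 (L f x)))
    (x : X) (K : Set X) (hK : IsMinimalSet T K) (hx : x ∈ K)
    (μ : Measure X) [IsProbabilityMeasure μ]
    (hμ : ∀ f : C(X, ℝ), ∫ y, f y ∂μ = L f x) : Ergodic T μ := by
  have hinv : ∀ f x, L f (T x) = L f x := fun f => s11_inv T f (L f) (hL f)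
  have hmp : MeasurePreserving T μ μ := by
    refine ⟨T.continuous.measurable, ?_⟩
    have : IsProbabilityMeasure (μ.map T) :=
      Measure.isProbabilityMeasure_map T.continuous.measurable.aemeasurable
    refine s11_ext _ _ fun f => ?_
    rw [integral_map T.continuous.measurable.aemeasurable f.continuous.aestronglyMeasurable,
      hμ f, ← hinv]
    refine (hμ (f.comp ⟨T, T.continuous⟩)).trans ?_
    refine tendsto_nhds_unique (hL _ x) ((hL f (T x)).congr fun n => ?_)
    unfold cesaro
    congr 1
    refine Finset.sum_congr rfl fun i _ => ?_
    simp only [ContinuousMap.comp_apply, ContinuousMap.coe_mk]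
    rw [← Function.iterate_succ_apply, Function.iterate_succ_apply']
  have hmem : ∀ n : ℕ, T^[n] x ∈ K := by
    intro n
    induction n with
    | zero => exact hx
    | succ n ih =>
      rw [Function.iterate_succ_apply']
      have := hK.2.2.1
      unfold IsInvariantSet at this
      rw [← this]
      exact ⟨_, ih, rfl⟩
  have hae : ∀ᵐ y ∂μ, y ∈ K := by
    let d : C(X, ℝ) := ⟨fun y => infDist y K, continuous_infDist_pt K⟩
    have h0 : ∫ y, d y ∂μ = 0 := by
      rw [hμ]
      refine tendsto_nhds_unique (hL d x) (tendsto_const_nhds.congr fun n => ?_)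
      unfold cesaro
      rw [Finset.sum_eq_zero, mul_zero]
      intro i _
      exact infDist_zero_of_mem (hmem i)
    rw [integral_eq_zero_iff_of_nonneg (f := d) (fun y => infDist_nonneg)
      (d.continuous.integrable_of_hasCompactSupport (HasCompactSupport.of_compactSpace _))] at h0
    filter_upwards [h0] with y hy
    exact (hK.2.1.mem_iff_infDist_zero hK.1).2 hy
  refine { toMeasurePreserving := hmp, aeconst_set := ?_ }
  intro s hs hTs
  have hmps : MeasurePreserving T (μ.restrict s) (μ.restrict s) := by
    have := hmp.restrict_preimage hs
    rwa [hTs] at this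
  have key : μ.restrict s = (μ s) • μ := by
    have : IsFiniteMeasure ((μ s) • μ) := Measure.smul_finite μ (measure_ne_top μ s)
    refine s11_ext _ _ fun f => ?_
    rw [s11_integral_lim T _ hmps f (L f) (hL f), integral_smul_measure, hμ f]
    have : ∀ᵐ y ∂(μ.restrict s), L f y = L f x := by
      filter_upwards [ae_restrict_of_ae hae] with y hy
      exact s11_const T (L f) (hc f) (hinv f) K hK x hx y hy
    rw [integral_congr_ae this]
    simp [measureReal_def]
  have h2 : μ s * μ sᶜ = 0 := by
    have := congrArg (fun m : Measure X => m sᶜ) key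
    simp [Measure.restrict_apply hs.compl] at this
    simpa using this
  rw [eventuallyConst_set']
  rcases mul_eq_zero.1 h2 with h | h
  · left; exact ae_eq_empty.2 h
  · right; exact ae_eq_univ.2 h

end Proof11

/-- every strictly uniform system is continuously strictly pointwise
ergodic. -/
theorem stmt_11 {X : Type*} [MetricSpace X] [CompactSpace X]
    [MeasurableSpace X] [BorelSpace X] (T : X ≃ₜ X)
    (h : StrictlyUniform T) :
    ContinuouslyStrictlyPointwiseErgodic T := by
  obtain ⟨hu, hs⟩ := h
  refine ⟨?_, hs⟩
  choose L hLu using hu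
  have hL : ∀ (f : C(X, ℝ)) (x : X), Tendsto (fun n => cesaro T f n x) atTop (𝓝 (L f x)) :=
    fun f x => (hLu f).tendsto_at x
  have hc : ∀ f, Continuous (L f) := fun f =>
    (hLu f).continuous (Frequently.of_forall fun n => s11_cesaro_cont T f n)
  choose Φ hΦ using fun x => s11_riesz T (fun f => L f x) x (fun f => hL f x)
  refine ⟨Φ, ?_, fun x => ⟨?_, ?_⟩⟩
  · rw [continuous_iff_continuousAt]
    intro x
    refine ProbabilityMeasure.tendsto_iff_forall_integral_tendsto.2 fun f => ?_
    have h1 : ∀ y, ∫ z, f z ∂(Φ y : Measure X) = L f.toContinuousMap y :=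
      fun y => hΦ y f.toContinuousMap
    simp only [h1]
    exact (hc _).continuousAt
  · obtain ⟨K, hK, hx⟩ := hs x
    exact s11_ergodic T L hc hL x K hK hx _ (hΦ x)
  · intro f
    rw [hΦ x f]
    exact hL f x
end

section
/- A topological dynamical system (X,T) is strictly uniform if and only if it is continuously strictly pointwise ergodic. -/
open MeasureTheory Filter Topology Metric

section Helpers

set_option linter.unusedSectionVars false

variable {X : Type*} [MetricSpace X] [CompactSpace X]
  [MeasurableSpace X] [BorelSpace X]

lemma aux_iterate_continuous (T : X ≃ₜ X) (i : ℕ) : Continuous (⇑T)^[i] :=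
  T.continuous.iterate i

lemma aux_cesaro_continuous (T : X ≃ₜ X) (f : C(X, ℝ)) (n : ℕ) :
    Continuous (fun x => cesaro (⇑T) (⇑f) n x) := by
  unfold cesaro
  refine continuous_const.mul (continuous_finsetSum _ fun i _ => ?_)
  exact f.continuous.comp (aux_iterate_continuous T i)

lemma aux_sum_bound (T : X ≃ₜ X) (f : C(X, ℝ)) (n : ℕ) (x : X) :
    |cesaro (⇑T) (⇑f) n x| ≤ ‖f‖ := by
  unfold cesaro
  rcases Nat.eq_zero_or_pos n with rfl | hn
  · simp
  have hn' : (0 : ℝ) < n := by exact_mod_cast hn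
  rw [abs_mul, abs_of_pos (inv_pos.2 hn'), inv_mul_le_iff₀ hn']
  calc |∑ i ∈ Finset.range n, f ((⇑T)^[i] x)| ≤ ∑ i ∈ Finset.range n, |f ((⇑T)^[i] x)| :=
        Finset.abs_sum_le_sum_abs _ _
    _ ≤ ∑ i ∈ Finset.range n, ‖f‖ := Finset.sum_le_sum fun i _ => f.norm_coe_le_norm _
    _ = n * ‖f‖ := by simp

lemma aux_shift (T : X ≃ₜ X) (f : C(X, ℝ)) (n : ℕ) (x : X) :
    |cesaro (⇑T) (⇑f) n (T x) - cesaro (⇑T) (⇑f) n x| ≤ (n : ℝ)⁻¹ * (2 * ‖f‖) := by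
  unfold cesaro
  rw [← mul_sub, ← Finset.sum_sub_distrib]
  have : ∑ i ∈ Finset.range n, (f ((⇑T)^[i] (T x)) - f ((⇑T)^[i] x))
      = f ((⇑T)^[n] x) - f ((⇑T)^[0] x) := by
    rw [← Finset.sum_range_sub (fun i => f ((⇑T)^[i] x))]
    rfl
  rw [this, abs_mul, abs_of_nonneg (by positivity : (0 : ℝ) ≤ (n : ℝ)⁻¹)]
  gcongr
  have h1 := f.norm_coe_le_norm ((⇑T)^[n] x)
  have h2 := f.norm_coe_le_norm ((⇑T)^[0] x)
  rw [Real.norm_eq_abs] at h1 h2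
  have := abs_sub (f ((⇑T)^[n] x)) (f ((⇑T)^[0] x))
  linarith

lemma aux_cesaro_comp (T : X ≃ₜ X) (f : X → ℝ) (n : ℕ) (x : X) :
    cesaro (⇑T) (fun y => f (T y)) n x = cesaro (⇑T) f n (T x) := by
  unfold cesaro
  congr 1
  refine Finset.sum_congr rfl fun i _ => ?_
  rw [← Function.iterate_succ_apply, Function.iterate_succ_apply']

lemma aux_shift_tendsto (T : X ≃ₜ X) (f : C(X, ℝ)) {l : Filter ℕ} {n : ℕ → ℕ}
    (hn : Tendsto n l atTop) (x : ℕ → X) {c : ℝ}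
    (h : Tendsto (fun k => cesaro (⇑T) (⇑f) (n k) (x k)) l (𝓝 c)) :
    Tendsto (fun k => cesaro (⇑T) (⇑f) (n k) (T (x k))) l (𝓝 c) := by
  have h0 : Tendsto (fun k => ((n k : ℕ) : ℝ)⁻¹ * (2 * ‖f‖)) l (𝓝 0) := by
    have := (tendsto_inv_atTop_nhds_zero_nat (𝕜 := ℝ)).comp hn
    simpa using this.mul_const (2 * ‖f‖)
  have h1 : Tendsto (fun k => cesaro (⇑T) (⇑f) (n k) (T (x k)) -
      cesaro (⇑T) (⇑f) (n k) (x k)) l (𝓝 0) :=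
    squeeze_zero_norm (fun k => aux_shift T f (n k) (x k)) h0
  simpa using h1.add h

lemma aux_integrable (ν : Measure X) [IsFiniteMeasure ν] (f : C(X, ℝ)) :
    Integrable (⇑f) ν :=
  (BoundedContinuousFunction.mkOfCompact f).integrable ν

lemma aux_empirical (T : X ≃ₜ X) (n : ℕ) (hn : n ≠ 0) (x : X) :
    ∃ μ : ProbabilityMeasure X, ∀ f : C(X, ℝ),
      ∫ y, f y ∂μ.toMeasure = cesaro (⇑T) (⇑f) n x := by
  let m : Measure X := (n : ENNReal)⁻¹ • ∑ i ∈ Finset.range n, Measure.dirac ((⇑T)^[i] x)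
  have hm : IsProbabilityMeasure m := by
    constructor
    simp only [m, Measure.smul_apply, Measure.finsetSum_apply, measure_univ, Finset.sum_const,
      Finset.card_range, smul_eq_mul, nsmul_eq_mul, mul_one]
    exact ENNReal.inv_mul_cancel (by exact_mod_cast hn) (ENNReal.natCast_ne_top n)
  refine ⟨⟨m, hm⟩, fun f => ?_⟩
  change ∫ y, f y ∂m = _
  simp only [m]
  rw [integral_smul_measure, integral_finsetSum_measure]
  · simp [cesaro]
  · intro i _
    exact aux_integrable _ f

lemma aux_invariant_of_integral (T : X ≃ₜ X) (ν : ProbabilityMeasure X)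
    (h : ∀ f : C(X, ℝ), ∫ y, f (T y) ∂ν.toMeasure = ∫ y, f y ∂ν.toMeasure) :
    MeasurePreserving (⇑T) ν.toMeasure ν.toMeasure := by
  refine ⟨T.continuous.measurable, ?_⟩
  have : IsProbabilityMeasure (ν.toMeasure.map ⇑T) :=
    Measure.isProbabilityMeasure_map T.continuous.measurable.aemeasurable
  refine ext_of_forall_integral_eq_of_IsFiniteMeasure fun f => ?_
  rw [integral_map T.continuous.measurable.aemeasurable
    f.continuous.aestronglyMeasurable]
  exact h f.toContinuousMap

lemma aux_limit (T : X ≃ₜ X) (U : Ultrafilter ℕ) (n : ℕ → ℕ)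
    (hn : Tendsto n U atTop) (x : ℕ → X) :
    ∃ ν : ProbabilityMeasure X,
      (∀ f : C(X, ℝ), Tendsto (fun k => cesaro (⇑T) (⇑f) (n k) (x k)) U
        (𝓝 (∫ y, f y ∂ν.toMeasure))) ∧
      MeasurePreserving (⇑T) ν.toMeasure ν.toMeasure := by
  have hx : Nonempty X := ⟨x 0⟩
  have : ∀ k, ∃ μ : ProbabilityMeasure X, n k ≠ 0 → ∀ f : C(X, ℝ),
      ∫ y, f y ∂μ.toMeasure = cesaro (⇑T) (⇑f) (n k) (x k) := by
    intro k
    by_cases h : n k = 0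
    · exact ⟨⟨Measure.dirac (x 0), inferInstance⟩, fun h' => absurd h h'⟩
    · obtain ⟨μ, hμ⟩ := aux_empirical T (n k) h (x k)
      exact ⟨μ, fun _ => hμ⟩
  choose μ hμ using this
  obtain ⟨ν, -, hν⟩ := isCompact_univ.ultrafilter_le_nhds (U.map μ) (by simp)
  have hν' : Tendsto μ U (𝓝 ν) := hν
  have key : ∀ f : C(X, ℝ), Tendsto (fun k => cesaro (⇑T) (⇑f) (n k) (x k)) U
        (𝓝 (∫ y, f y ∂ν.toMeasure)) := by
    intro f
    have h1 := ((ProbabilityMeasure.continuous_integral_continuousMap f).tendsto ν).comp hν'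
    refine h1.congr' ?_
    filter_upwards [hn.eventually_ne_atTop 0] with k hk
    exact hμ k hk f
  refine ⟨ν, key, aux_invariant_of_integral T ν fun f => ?_⟩
  have h2 := key (f.comp ⟨⇑T, T.continuous⟩)
  have h3 := aux_shift_tendsto T f hn x (key f)
  refine tendsto_nhds_unique h2 (h3.congr fun k => ?_)
  exact (aux_cesaro_comp T f (n k) (x k)).symm

lemma aux_setIntegral (T : X ≃ₜ X) (ν : Measure X) [IsProbabilityMeasure ν]
    (hν : MeasurePreserving (⇑T) ν ν) {A : Set X} (hA : MeasurableSet A)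
    (hTA : ⇑T ⁻¹' A = A) (f : C(X, ℝ)) (h : X → ℝ)
    (hlim : ∀ᵐ y ∂ν, Tendsto (fun n => cesaro (⇑T) (⇑f) n y) atTop (𝓝 (h y))) :
    ∫ y in A, f y ∂ν = ∫ y in A, h y ∂ν := by
  have hT : MeasurePreserving (⇑T) (ν.restrict A) (ν.restrict A) := by
    have := hν.restrict_preimage hA
    rwa [hTA] at this
  have hn : ∀ n : ℕ, n ≠ 0 → ∫ y in A, cesaro (⇑T) (⇑f) n y ∂ν = ∫ y in A, f y ∂ν := by
    intro n hn
    unfold cesaro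
    rw [integral_const_mul, integral_finsetSum]
    · have : ∀ i ∈ Finset.range n, ∫ y in A, f ((⇑T)^[i] y) ∂ν = ∫ y in A, f y ∂ν := by
        intro i _
        rw [← integral_map (f := ⇑f) (hT.iterate i).measurable.aemeasurable
          f.continuous.aestronglyMeasurable, (hT.iterate i).map_eq]
      rw [Finset.sum_congr rfl this]
      simp [hn]
    · intro i _
      exact aux_integrable _ (f.comp ⟨_, aux_iterate_continuous T i⟩)
  have hD : Tendsto (fun n => ∫ y in A, cesaro (⇑T) (⇑f) n y ∂ν) atTop
      (𝓝 (∫ y in A, h y ∂ν)) := by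
    refine tendsto_integral_of_dominated_convergence (fun _ => ‖f‖) ?_ ?_ ?_ ?_
    · intro n
      exact (aux_cesaro_continuous T f n).aestronglyMeasurable
    · exact integrable_const _
    · intro n
      exact Eventually.of_forall fun y => aux_sum_bound T f n y
    · exact ae_restrict_of_ae hlim
  refine tendsto_nhds_unique ?_ hD
  refine tendsto_const_nhds.congr' ?_
  filter_upwards [eventually_ne_atTop 0] with n h0
  exact (hn n h0).symm

lemma aux_ergodic (T : X ≃ₜ X) (ν : Measure X) [IsProbabilityMeasure ν]
    (hν : MeasurePreserving (⇑T) ν ν)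
    (hlim : ∀ f : C(X, ℝ), ∀ᵐ y ∂ν,
      Tendsto (fun n => cesaro (⇑T) (⇑f) n y) atTop (𝓝 (∫ z, f z ∂ν))) :
    Ergodic (⇑T) ν := by
  refine ⟨hν, ⟨fun A hA hTA => ?_⟩⟩
  have heq : ν.restrict A = ν A • ν := by
    have : IsFiniteMeasure (ν A • ν) := Measure.smul_finite ν (measure_ne_top ν A)
    refine ext_of_forall_integral_eq_of_IsFiniteMeasure fun f => ?_
    have := aux_setIntegral T ν hν hA hTA f.toContinuousMap _ (hlim f.toContinuousMap)
    rw [integral_smul_measure]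
    rw [setIntegral_const] at this
    exact this
  have h2 : ν.restrict A Aᶜ = 0 := by
    rw [Measure.restrict_apply hA.compl]; simp
  rw [heq, Measure.smul_apply, smul_eq_mul, mul_eq_zero] at h2
  rw [eventuallyConst_set']
  rcases h2 with h | h
  · left; exact ae_eq_empty.2 h
  · right; exact ae_eq_univ.2 h

lemma aux_cesaro_tendsto_shift (T : X ≃ₜ X) (f : C(X, ℝ)) (x : X) {c : ℝ}
    (h : Tendsto (fun n => cesaro (⇑T) (⇑f) n x) atTop (𝓝 c)) :
    Tendsto (fun n => cesaro (⇑T) (⇑f) n (T x)) atTop (𝓝 c) :=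
  aux_shift_tendsto T f tendsto_id (fun _ => x) h

lemma aux_backward (T : X ≃ₜ X) (h : ContinuouslyPointwiseErgodic T) : UniformSystem T := by
  obtain ⟨Φ, hΦ, hg⟩ := h
  intro f
  let g : C(X, ℝ) := ⟨fun x => ∫ y, f y ∂(Φ x).toMeasure,
    (ProbabilityMeasure.continuous_integral_continuousMap f).comp hΦ⟩
  have hgl : ∀ x, Tendsto (fun n => cesaro (⇑T) (⇑f) n x) atTop (𝓝 (g x)) :=
    fun x => (hg x).2 f
  have hginv : ∀ x, g (T x) = g x := fun x =>
    tendsto_nhds_unique (hgl (T x)) (aux_cesaro_tendsto_shift T f x (hgl x))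
  have hgit : ∀ i x, g ((⇑T)^[i] x) = g x := by
    intro i
    induction i with
    | zero => intro x; rfl
    | succ i ih => intro x; rw [Function.iterate_succ_apply, ih, hginv]
  have hgc : ∀ n x, n ≠ 0 → cesaro (⇑T) (⇑g) n x = g x := by
    intro n x hn
    unfold cesaro
    rw [Finset.sum_congr rfl fun i _ => hgit i x]
    simp [hn]
  refine ⟨g, ?_⟩
  rw [Metric.tendstoUniformly_iff]
  by_contra hcon
  push Not at hcon
  obtain ⟨ε, hε, hfr⟩ := hcon
  obtain ⟨φ, hφ, hx⟩ := extraction_of_frequently_atTop hfr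
  choose x hx using hx
  obtain ⟨ν, hlim, hinv⟩ := aux_limit T (hyperfilter ℕ) φ
    (hφ.tendsto_atTop.mono_left Nat.hyperfilter_le_atTop) x
  have heq : ∫ y, f y ∂ν.toMeasure = ∫ y, g y ∂ν.toMeasure := by
    have := aux_setIntegral T ν.toMeasure hinv MeasurableSet.univ Set.preimage_univ f g
      (Eventually.of_forall hgl)
    simpa using this
  have h0 := (hlim g).sub (hlim f)
  rw [heq, sub_self] at h0
  have h1 := (Metric.tendsto_nhds.1 h0) ε hε
  have h2 : ∀ᶠ k in (hyperfilter ℕ : Filter ℕ), φ k ≠ 0 :=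
    (hφ.tendsto_atTop.mono_left Nat.hyperfilter_le_atTop).eventually_ne_atTop 0
  obtain ⟨k, hk1, hk2⟩ := (h1.and h2).exists
  rw [hgc _ _ hk2, Real.dist_0_eq_abs, ← Real.dist_eq] at hk1
  exact absurd hk1 (not_lt.2 (hx k))

lemma aux_forward (T : X ≃ₜ X) (h : UniformSystem T) (hs : SemiSimple T) :
    ContinuouslyPointwiseErgodic T := by
  choose g hg using h
  have hgl : ∀ (f : C(X, ℝ)) (x : X), Tendsto (fun n => cesaro (⇑T) (⇑f) n x) atTop (𝓝 (g f x)) :=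
    fun f x => (hg f).tendsto_at x
  have hgcont : ∀ f, Continuous (g f) := fun f =>
    (hg f).continuous (Frequently.of_forall fun n => aux_cesaro_continuous T f n)
  have hginv : ∀ f x, g f (T x) = g f x := fun f x =>
    tendsto_nhds_unique (hgl f (T x)) (aux_cesaro_tendsto_shift T f x (hgl f x))
  have hex : ∀ x, ∃ ν : ProbabilityMeasure X, (∀ f : C(X, ℝ), ∫ y, f y ∂ν.toMeasure = g f x) ∧
      MeasurePreserving (⇑T) ν.toMeasure ν.toMeasure := by
    intro x
    obtain ⟨ν, hlim, hinv⟩ := aux_limit T (hyperfilter ℕ) id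
      (tendsto_id.mono_left Nat.hyperfilter_le_atTop) (fun _ => x)
    exact ⟨ν, fun f => tendsto_nhds_unique (hlim f)
      ((hgl f x).mono_left Nat.hyperfilter_le_atTop), hinv⟩
  choose Φ hΦ hinv using hex
  refine ⟨Φ, ?_, fun x => ⟨?_, fun f => ?_⟩⟩
  · rw [ProbabilityMeasure.continuous_iff_forall_continuousMap_continuous_integral]
    intro f
    exact (hgcont f).congr fun x => (hΦ x f).symm
  · obtain ⟨K, ⟨hKne, hKc, hKinv, hKmin⟩, hxK⟩ := hs x
    have hTK : ∀ y ∈ K, T y ∈ K := fun y hy => hKinv ▸ Set.mem_image_of_mem _ hy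
    have hKit : ∀ i, ∀ y ∈ K, (⇑T)^[i] y ∈ K := by
      intro i
      induction i with
      | zero => intro y hy; exact hy
      | succ i ih => intro y hy; rw [Function.iterate_succ_apply]; exact ih _ (hTK y hy)
    have hconst : ∀ f : C(X, ℝ), ∀ y ∈ K, g f y = g f x := by
      intro f
      have := hKmin (K ∩ {y | g f y = g f x}) Set.inter_subset_left ⟨x, hxK, rfl⟩
        (hKc.inter (isClosed_eq (hgcont f) continuous_const)) ?_
      · intro y hy
        rw [← this] at hy
        exact hy.2
      · apply Set.Subset.antisymm
        · rintro _ ⟨y, ⟨hy, hy'⟩, rfl⟩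
          exact ⟨hTK y hy, (hginv f y).trans hy'⟩
        · rintro y ⟨hy, hy'⟩
          rw [← hKinv] at hy
          obtain ⟨z, hz, rfl⟩ := hy
          exact ⟨z, ⟨hz, (hginv f z).symm.trans hy'⟩, rfl⟩
    have hae : ∀ᵐ y ∂(Φ x).toMeasure, y ∈ K := by
      let d : C(X, ℝ) := ⟨fun y => infDist y K, continuous_infDist_pt K⟩
      have hd : ∫ y, d y ∂(Φ x).toMeasure = 0 := by
        rw [hΦ x d]
        refine tendsto_nhds_unique (hgl d x) ?_
        refine tendsto_const_nhds.congr fun n => ?_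
        unfold cesaro
        rw [Finset.sum_eq_zero, mul_zero]
        intro i _
        exact infDist_zero_of_mem (hKit i x hxK)
      rw [integral_eq_zero_iff_of_nonneg (f := ⇑d) (fun y => infDist_nonneg) (aux_integrable _ d)] at hd
      filter_upwards [hd] with y hy
      exact (hKc.mem_iff_infDist_zero hKne).2 hy
    refine aux_ergodic T _ (hinv x) fun f => ?_
    filter_upwards [hae] with y hy
    rw [hΦ x f, ← hconst f y hy]
    exact hgl f y
  · rw [hΦ x f]
    exact hgl f x

end Helpers

/-- `(X,T)` is strictly uniform iff it is continuously strictly pointwise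
ergodic. -/
theorem stmt_13 {X : Type*} [MetricSpace X] [CompactSpace X]
    [MeasurableSpace X] [BorelSpace X] (T : X ≃ₜ X) :
    StrictlyUniform T ↔ ContinuouslyStrictlyPointwiseErgodic T := by
  exact ⟨fun h => ⟨aux_forward T h.1 h.2, h.2⟩, fun h => ⟨aux_backward T h.1, h.2⟩⟩
end

section
/- Let (X,T) be a partitionable topological dynamical system and let M denote the union of all minimal subsets of X. Then M is closed and the subsystem (M,T) is strictly uniform if and only if the set ℳ_T^e(X) of ergodic measures is compact in the weak-star topology and the set-valued function supp : ℳ_T^e(X) → 2^X is continuous. -/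
open MeasureTheory Filter Topology Metric

section Helpers

set_option linter.unusedSectionVars false

variable {X : Type*} [MetricSpace X] [CompactSpace X]
  [MeasurableSpace X] [BorelSpace X]

lemma cont_integrable (f : C(X, ℝ)) (μ : ProbabilityMeasure X) :
    Integrable (⇑f) μ.toMeasure :=
  (BoundedContinuousFunction.mkOfCompact f).integrable _

lemma pm_ext {μ ν : ProbabilityMeasure X}
    (h : ∀ f : C(X, ℝ), ∫ y, f y ∂μ.toMeasure = ∫ y, f y ∂ν.toMeasure) : μ = ν := by
  apply Subtype.ext
  have i1 : IsFiniteMeasure μ.toMeasure := inferInstance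
  have i2 : IsFiniteMeasure ν.toMeasure := inferInstance
  change μ.toMeasure = ν.toMeasure
  apply ext_of_forall_integral_eq_of_IsFiniteMeasure
  intro f
  exact h f.toContinuousMap

lemma pm_tendsto {ι : Type*} {l : Filter ι} {μs : ι → ProbabilityMeasure X}
    {μ : ProbabilityMeasure X} :
    Tendsto μs l (𝓝 μ) ↔ ∀ f : C(X, ℝ),
      Tendsto (fun i => ∫ y, f y ∂(μs i).toMeasure) l (𝓝 (∫ y, f y ∂μ.toMeasure)) := by
  rw [ProbabilityMeasure.tendsto_iff_forall_integral_tendsto]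
  constructor
  · intro h f
    exact h (BoundedContinuousFunction.mkOfCompact f)
  · intro h f
    exact h f.toContinuousMap

lemma cesaro_abs_le (T : X ≃ₜ X) (f : C(X, ℝ)) (n : ℕ) (x : X) :
    |cesaro T f n x| ≤ ‖f‖ := by
  unfold cesaro
  rw [abs_mul, abs_of_nonneg (by positivity : (0:ℝ) ≤ (n:ℝ)⁻¹)]
  have h1 : |∑ i ∈ Finset.range n, f (T^[i] x)| ≤ n * ‖f‖ := by
    refine (Finset.abs_sum_le_sum_abs _ _).trans ?_
    calc _ ≤ ∑ i ∈ Finset.range n, ‖f‖ :=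
          Finset.sum_le_sum fun i _ => f.norm_coe_le_norm _
      _ = n * ‖f‖ := by simp
  rcases Nat.eq_zero_or_pos n with rfl | hn
  · simp
  · have : (0:ℝ) < n := by exact_mod_cast hn
    calc _ ≤ (n:ℝ)⁻¹ * (n * ‖f‖) := by gcongr
      _ = ‖f‖ := by field_simp

lemma cesaro_cont (T : X ≃ₜ X) (f : C(X, ℝ)) (n : ℕ) : Continuous (cesaro T f n) := by
  unfold cesaro
  refine continuous_const.mul (continuous_finsetSum _ fun i _ => ?_)
  exact f.continuous.comp (T.continuous.iterate i)

lemma cesaro_shift (T : X ≃ₜ X) (f : C(X, ℝ)) (n : ℕ) (x : X) :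
    |cesaro T f n (T x) - cesaro T f n x| ≤ (n:ℝ)⁻¹ * (2 * ‖f‖) := by
  unfold cesaro
  rw [← mul_sub, abs_mul, abs_of_nonneg (by positivity : (0:ℝ) ≤ (n:ℝ)⁻¹)]
  gcongr
  rw [← Finset.sum_sub_distrib]
  have : ∑ i ∈ Finset.range n, (f (T^[i] (T x)) - f (T^[i] x)) = f (T^[n] x) - f x := by
    simpa using Finset.sum_range_sub (fun i => f (T^[i] x)) n
  rw [this]
  have h1 := f.norm_coe_le_norm (T^[n] x)
  have h2 := f.norm_coe_le_norm x
  rw [Real.norm_eq_abs] at h1 h2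
  refine (abs_sub _ _).trans ?_
  linarith

lemma cesaro_shift' (T : X ≃ₜ X) (f : C(X, ℝ)) (n : ℕ) (x : X) :
    cesaro T (f.comp (⟨T, T.continuous⟩ : C(X, X))) n x = cesaro T f n (T x) := by
  unfold cesaro
  congr 1
  refine Finset.sum_congr rfl fun i _ => ?_
  simp [← Function.iterate_succ_apply, Function.iterate_succ_apply']

lemma exists_empirical (T : X ≃ₜ X) (n : ℕ) (hn : 0 < n) (x : X) :
    ∃ μ : ProbabilityMeasure X, ∀ f : C(X, ℝ), ∫ y, f y ∂μ.toMeasure = cesaro T f n x := by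
  let m : Measure X := (n : ENNReal)⁻¹ • ∑ i ∈ Finset.range n, Measure.dirac (T^[i] x)
  have hm : IsProbabilityMeasure m := by
    constructor
    simp only [m, Measure.smul_apply, Measure.finsetSum_apply, measure_univ, smul_eq_mul]
    simp
    exact ENNReal.inv_mul_cancel (by simp; omega) (by simp)
  refine ⟨⟨m, hm⟩, fun f => ?_⟩
  change ∫ y, f y ∂m = _
  simp only [m]
  rw [integral_smul_measure, integral_finsetSum_measure]
  · simp [cesaro]
  · intro i _
    exact (BoundedContinuousFunction.mkOfCompact f).integrable _

lemma inv_of_integral (T : X ≃ₜ X) (ν : ProbabilityMeasure X)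
    (h : ∀ f : C(X, ℝ), ∫ y, f (T y) ∂ν.toMeasure = ∫ y, f y ∂ν.toMeasure) :
    IsInvariantMeasure T ν := by
  unfold IsInvariantMeasure
  have : IsProbabilityMeasure (ν.toMeasure.map T) :=
    Measure.isProbabilityMeasure_map T.continuous.measurable.aemeasurable
  apply ext_of_forall_integral_eq_of_IsFiniteMeasure
  intro f
  rw [integral_map T.continuous.measurable.aemeasurable
    f.continuous.aestronglyMeasurable]
  exact h f.toContinuousMap

/-- Krylov–Bogoliubov along a sequence. -/
lemma krylov (T : X ≃ₜ X) (x : ℕ → X) (n : ℕ → ℕ) (hn : Tendsto n atTop atTop) :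
    ∃ (φ : ℕ → ℕ) (ν : ProbabilityMeasure X), StrictMono φ ∧ IsInvariantMeasure T ν ∧
      ∀ f : C(X, ℝ), Tendsto (fun k => cesaro T f (n (φ k)) (x (φ k))) atTop
        (𝓝 (∫ y, f y ∂ν.toMeasure)) := by
  have he : ∀ k, ∃ μ : ProbabilityMeasure X, 0 < n k → 
      ∀ f : C(X, ℝ), ∫ y, f y ∂μ.toMeasure = cesaro T f (n k) (x k) := by
    intro k
    by_cases h : 0 < n k
    · obtain ⟨μ, hμ⟩ := exists_empirical T (n k) h (x k)
      exact ⟨μ, fun _ => hμ⟩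
    · exact ⟨⟨Measure.dirac (x k), inferInstance⟩, fun h' => absurd h' h⟩
  choose e he using he
  obtain ⟨ν, φ, hφ, hlim⟩ := CompactSpace.tendsto_subseq e
  have hnφ : Tendsto (fun k => n (φ k)) atTop atTop := hn.comp hφ.tendsto_atTop
  have hl : ∀ f : C(X, ℝ), Tendsto (fun k => cesaro T f (n (φ k)) (x (φ k))) atTop
        (𝓝 (∫ y, f y ∂ν.toMeasure)) := by
    intro f
    refine (pm_tendsto.1 hlim f).congr' ?_
    filter_upwards [hnφ.eventually_gt_atTop 0] with k hk
    exact he _ hk f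
  refine ⟨φ, ν, hφ, inv_of_integral T ν fun f => ?_, hl⟩
  have h1 := hl (f.comp (⟨T, T.continuous⟩ : C(X, X)))
  have h2 := hl f
  have h3 := h1.sub h2
  have h4 : Tendsto (fun k => cesaro T (f.comp (⟨T, T.continuous⟩ : C(X, X))) (n (φ k)) (x (φ k))
      - cesaro T f (n (φ k)) (x (φ k))) atTop (𝓝 0) := by
    refine squeeze_zero_norm (a := fun k => ((n (φ k) : ℕ) : ℝ)⁻¹ * (2 * ‖f‖)) ?_ ?_
    · intro k
      rw [cesaro_shift']
      exact cesaro_shift T f _ _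
    · have : Tendsto (fun k => ((n (φ k) : ℕ) : ℝ)⁻¹) atTop (𝓝 0) :=
        tendsto_inv_atTop_zero.comp (tendsto_natCast_atTop_atTop.comp hnφ)
      simpa using this.mul_const (2 * ‖f‖)
  have := tendsto_nhds_unique h3 h4
  exact sub_eq_zero.1 this

/-- If the orbits are close to the closed set `K`, the limit measure lives on `K`. -/
lemma krylov_supp (T : X ≃ₜ X) (x : ℕ → X) (n : ℕ → ℕ) (δ : ℕ → ℝ)
    (ν : ProbabilityMeasure X)
    (hδ : Tendsto δ atTop (𝓝 0)) (hδ0 : ∀ k, 0 ≤ δ k) (K : Set X) (hK : IsClosed K) (hne : K.Nonempty)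
    (hx : ∀ k i, infDist (T^[i] (x k)) K ≤ δ k)
    (hν : ∀ f : C(X, ℝ), Tendsto (fun k => cesaro T f (n k) (x k)) atTop
        (𝓝 (∫ y, f y ∂ν.toMeasure))) : ν.toMeasure K = 1 := by
  let f : C(X, ℝ) := ⟨fun y => infDist y K, continuous_infDist_pt K⟩
  have h0 : Tendsto (fun k => cesaro T f (n k) (x k)) atTop (𝓝 0) := by
    refine squeeze_zero (fun k => ?_) (fun k => ?_) hδ
    · unfold cesaro
      exact mul_nonneg (by positivity) (Finset.sum_nonneg fun i _ => infDist_nonneg)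
    · unfold cesaro
      have h1 : ∑ i ∈ Finset.range (n k), f (T^[i] (x k)) ≤ n k * δ k := by
        calc _ ≤ ∑ i ∈ Finset.range (n k), δ k := Finset.sum_le_sum fun i _ => hx k i
          _ = _ := by simp
      rcases Nat.eq_zero_or_pos (n k) with h | h
      · simp [h, hδ0]
      · have : (0:ℝ) < n k := by exact_mod_cast h
        calc _ ≤ (n k:ℝ)⁻¹ * (n k * δ k) := by gcongr
          _ = δ k := by field_simp
  have h1 : ∫ y, f y ∂ν.toMeasure = 0 := tendsto_nhds_unique (hν f) h0
  have hf0 : (0 : X → ℝ) ≤ ⇑f := fun y => infDist_nonneg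
  rw [integral_eq_zero_iff_of_nonneg hf0 (cont_integrable f ν)] at h1
  rw [prob_compl_eq_zero_iff hK.measurableSet |>.symm]
  rw [measure_eq_zero_iff_ae_notMem]
  filter_upwards [h1] with y hy
  simp only [Set.mem_compl_iff, not_not]
  exact (hK.mem_iff_infDist_zero hne).2 hy

lemma iter_mem (T : X ≃ₜ X) {K : Set X} (hK : IsInvariantSet T K) {x : X} (hx : x ∈ K) (i : ℕ) :
    T^[i] x ∈ K := by
  induction i with
  | zero => exact hx
  | succ i ih =>
    rw [Function.iterate_succ_apply']
    have := Set.mem_image_of_mem T ih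
    rwa [hK] at this

/-- Sequences in an invariant set give limit measures on it. -/
lemma exists_inv_on (T : X ≃ₜ X) {K : Set X} (hK : IsInvariantSet T K) (hc : IsClosed K)
    (x : X) (hx : x ∈ K) (n : ℕ → ℕ) (hn : Tendsto n atTop atTop) :
    ∃ (φ : ℕ → ℕ) (ν : ProbabilityMeasure X), StrictMono φ ∧ IsInvariantMeasure T ν ∧
      ν.toMeasure K = 1 ∧
      ∀ f : C(X, ℝ), Tendsto (fun k => cesaro T f (n (φ k)) x) atTop
        (𝓝 (∫ y, f y ∂ν.toMeasure)) := by
  obtain ⟨φ, ν, hφ, hinv, hl⟩ := krylov T (fun _ => x) n hn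
  refine ⟨φ, ν, hφ, hinv, ?_, hl⟩
  refine krylov_supp T (fun _ => x) (fun k => n (φ k)) (fun _ => 0) ν tendsto_const_nhds (fun _ => le_rfl) K hc
    ⟨x, hx⟩ (fun k i => ?_) hl
  exact (infDist_zero_of_mem (iter_mem T hK hx i)).le

lemma generic_of_ue (T : X ≃ₜ X) {K : Set X} (hK : IsInvariantSet T K) (hc : IsClosed K)
    (μ : ProbabilityMeasure X)
    (hu : ∀ ν : ProbabilityMeasure X, IsInvariantMeasure T ν → ν.toMeasure K = 1 → ν = μ)
    (x : X) (hx : x ∈ K) : IsGenericFor T x μ := by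
  intro f
  apply tendsto_of_subseq_tendsto
  intro n hn
  obtain ⟨φ, ν, hφ, hinv, h1, hl⟩ := exists_inv_on T hK hc x hx n hn
  obtain rfl := hu ν hinv h1
  exact ⟨φ, hl f⟩

lemma msupp_eq (μ : ProbabilityMeasure X) : msupp μ = μ.toMeasure.support := by
  ext x
  rw [Measure.mem_support_iff_forall]
  constructor
  · intro h U hU
    obtain ⟨V, hVU, hV, hx⟩ := _root_.mem_nhds_iff.1 hU
    exact (h V hV hx).trans_le (measure_mono hVU)
  · intro h U hU hx
    exact h U (hU.mem_nhds hx)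

lemma msupp_closed (μ : ProbabilityMeasure X) : IsClosed (msupp μ) := by
  rw [msupp_eq]; exact Measure.isClosed_support

lemma msupp_full (μ : ProbabilityMeasure X) : μ.toMeasure (msupp μ) = 1 := by
  rw [msupp_eq, ← prob_compl_eq_zero_iff Measure.isClosed_support.measurableSet]
  exact Measure.measure_compl_support

lemma msupp_ne (μ : ProbabilityMeasure X) : (msupp μ).Nonempty := by
  rw [Set.nonempty_iff_ne_empty]
  intro h
  have := msupp_full μ
  simp [h] at this

lemma msupp_sub (μ : ProbabilityMeasure X) {K : Set X} (hc : IsClosed K)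
    (h : μ.toMeasure K = 1) : msupp μ ⊆ K := by
  intro x hx
  by_contra hxK
  have := hx Kᶜ hc.isOpen_compl hxK
  rw [(prob_compl_eq_zero_iff hc.measurableSet).2 h] at this
  exact lt_irrefl _ this

lemma msupp_inv (T : X ≃ₜ X) (μ : ProbabilityMeasure X) (h : IsInvariantMeasure T μ) :
    IsInvariantSet T (msupp μ) := by
  have key : ∀ U : Set X, IsOpen U → μ.toMeasure (T ⁻¹' U) = μ.toMeasure U := by
    intro U hU
    conv_rhs => rw [← h]
    rw [Measure.map_apply T.continuous.measurable hU.measurableSet]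
  unfold IsInvariantSet
  apply Set.Subset.antisymm
  · rintro _ ⟨x, hx, rfl⟩ U hU hxU
    rw [← key U hU]
    exact hx _ (hU.preimage T.continuous) hxU
  · intro x hx
    refine ⟨T.symm x, ?_, by simp⟩
    intro U hU hxU
    have hU' : IsOpen (T.symm ⁻¹' U) := hU.preimage T.symm.continuous
    have := hx _ hU' hxU
    rw [← key _ hU'] at this
    convert this using 2
    ext y; simp

lemma ergodic_of_ue (T : X ≃ₜ X) {K : Set X} (hc : IsClosed K)
    (μ : ProbabilityMeasure X) (hμ : IsInvariantMeasure T μ) (h1 : μ.toMeasure K = 1)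
    (hu : ∀ ν : ProbabilityMeasure X, IsInvariantMeasure T ν → ν.toMeasure K = 1 → ν = μ) :
    IsErgodicMeasure T μ := by
  refine ⟨⟨T.continuous.measurable, hμ⟩, ⟨fun A hA hinv => ?_⟩⟩
  rw [eventuallyConst_set']
  by_cases h0 : μ.toMeasure A = 0
  · left
    exact ae_eq_empty.2 h0
  right
  let ν : ProbabilityMeasure X :=
    ⟨ProbabilityTheory.cond μ.toMeasure A, ProbabilityTheory.cond_isProbabilityMeasure h0⟩
  have hν : ν = μ := by
    apply hu
    · change Measure.map T (ProbabilityTheory.cond μ.toMeasure A) = ProbabilityTheory.cond μ.toMeasure A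
      ext B hB
      rw [Measure.map_apply T.continuous.measurable hB, ProbabilityTheory.cond_apply hA,
        ProbabilityTheory.cond_apply hA]
      congr 1
      conv_rhs => rw [← hμ, Measure.map_apply T.continuous.measurable (hA.inter hB),
        Set.preimage_inter, hinv]
    · change ProbabilityTheory.cond μ.toMeasure A K = 1
      have := ProbabilityTheory.cond_isProbabilityMeasure h0
      rw [← prob_compl_eq_zero_iff hc.measurableSet]
      exact ProbabilityTheory.cond_absolutelyContinuous
        ((prob_compl_eq_zero_iff hc.measurableSet).2 h1)
  rw [← hν]
  change A =ᵐ[ProbabilityTheory.cond μ.toMeasure A] _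
  rw [eventuallyEq_univ]
  exact ProbabilityTheory.ae_cond_mem hA

lemma ergodic_inv {T : X ≃ₜ X} {μ : ProbabilityMeasure X} (h : IsErgodicMeasure T μ) :
    IsInvariantMeasure T μ := h.toMeasurePreserving.map_eq

lemma integral_cont (μ : ProbabilityMeasure X) :
    Continuous (fun f : C(X, ℝ) => ∫ y, f y ∂μ.toMeasure) := by
  refine LipschitzWith.continuous (K := 1) (LipschitzWith.of_dist_le_mul fun f g => ?_)
  rw [Real.dist_eq, ← integral_sub (cont_integrable f μ) (cont_integrable g μ)]
  have := norm_integral_le_of_norm_le_const (μ := μ.toMeasure) (f := fun y => f y - g y)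
    (C := dist f g) (Eventually.of_forall fun y => by
      rw [← dist_eq_norm]; exact ContinuousMap.dist_apply_le_dist y)
  simpa using this

lemma ergodic_surj (T : X ≃ₜ X) (Φ : X → ProbabilityMeasure X)
    (hg : ∀ x, IsGenericFor T x (Φ x)) (μ : ProbabilityMeasure X) (hμ : IsErgodicMeasure T μ) :
    ∃ x, Φ x = μ := by
  have key : ∀ f : C(X, ℝ), ∀ᵐ x ∂μ.toMeasure,
      ∫ y, f y ∂(Φ x).toMeasure = ∫ y, f y ∂μ.toMeasure := by
    intro f
    let F : X → ℝ := fun x => ∫ y, f y ∂(Φ x).toMeasure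
    have hF : Measurable F := measurable_of_tendsto_metrizable
      (fun n => (cesaro_cont T f n).measurable) (tendsto_pi_nhds.2 fun x => hg x f)
    have hinv : F ∘ T = F := by
      ext x
      have h1 := (hg (T x) f).sub (hg x f)
      have h2 : Tendsto (fun n => cesaro T f n (T x) - cesaro T f n x) atTop (𝓝 0) := by
        refine squeeze_zero_norm (fun n => cesaro_shift T f n x) ?_
        simpa using (tendsto_inv_atTop_nhds_zero_nat (𝕜 := ℝ)).mul_const (2 * ‖f‖)
      exact sub_eq_zero.1 (tendsto_nhds_unique h1 h2)
    obtain ⟨c, hc⟩ := hμ.toPreErgodic.ae_eq_const_of_ae_eq_comp hF hinv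
    have hint : ∀ n : ℕ, 0 < n → ∫ x, cesaro T f n x ∂μ.toMeasure = ∫ x, f x ∂μ.toMeasure := by
      intro n hn
      unfold cesaro
      rw [integral_const_mul, integral_finsetSum]
      · have : ∀ i ∈ Finset.range n, ∫ x, f (T^[i] x) ∂μ.toMeasure = ∫ x, f x ∂μ.toMeasure := by
          intro i _
          have hp := hμ.toMeasurePreserving.iterate i
          conv_rhs => rw [← hp.map_eq]
          rw [integral_map hp.measurable.aemeasurable f.continuous.aestronglyMeasurable]
        rw [Finset.sum_congr rfl this]
        have : (0:ℝ) < n := by exact_mod_cast hn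
        simp
        field_simp
      · intro i _
        exact cont_integrable (f.comp ⟨T^[i], T.continuous.iterate i⟩) μ
    have hdom : Tendsto (fun n => ∫ x, cesaro T f n x ∂μ.toMeasure) atTop
        (𝓝 (∫ x, F x ∂μ.toMeasure)) := by
      refine tendsto_integral_of_dominated_convergence (fun _ => ‖f‖)
        (fun n => (cesaro_cont T f n).aestronglyMeasurable) (integrable_const _) ?_ ?_
      · intro n
        exact Eventually.of_forall fun x => cesaro_abs_le T f n x
      · exact Eventually.of_forall fun x => hg x f
    have hcst : Tendsto (fun n => ∫ x, cesaro T f n x ∂μ.toMeasure) atTop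
        (𝓝 (∫ x, f x ∂μ.toMeasure)) := by
      refine tendsto_const_nhds.congr' ?_
      filter_upwards [eventually_gt_atTop 0] with n hn
      exact (hint n hn).symm
    have h3 := tendsto_nhds_unique hdom hcst
    rw [integral_congr_ae hc] at h3
    simp at h3
    filter_upwards [hc] with x hx
    rw [← h3]
    exact hx
  have hd := TopologicalSpace.denseRange_denseSeq C(X, ℝ)
  have hall := ae_all_iff.2 fun n : ℕ => key (TopologicalSpace.denseSeq C(X, ℝ) n)
  obtain ⟨x, hx⟩ := hall.exists
  refine ⟨x, pm_ext fun f => ?_⟩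
  have := hd.equalizer (integral_cont (Φ x)) (integral_cont μ) (funext hx)
  exact congrFun this f

lemma partition_data (T : X ≃ₜ X) (hp : Partitionable T) :
    ∃ Φ : X → ProbabilityMeasure X,
      (∀ x, IsErgodicMeasure T (Φ x)) ∧ (∀ x, IsGenericFor T x (Φ x)) ∧
      (∀ y, ∀ x ∈ msupp (Φ y), Φ x = Φ y) ∧
      (∀ x, IsMinimalSet T (msupp (Φ x))) ∧
      (∀ K x, IsMinimalSet T K → x ∈ K → K = msupp (Φ x)) ∧
      (∀ y (ν : ProbabilityMeasure X), IsInvariantMeasure T ν →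
        ν.toMeasure (msupp (Φ y)) = 1 → ν = Φ y) := by
  obtain ⟨P, ⟨_, hP⟩, hK⟩ := hp
  choose A hA hAu using hP
  have hμ : ∀ x, ∃ μ : ProbabilityMeasure X, IsInvariantMeasure T μ ∧ μ.toMeasure (A x) = 1 ∧
      ∀ ν : ProbabilityMeasure X, IsInvariantMeasure T ν → ν.toMeasure (A x) = 1 → ν = μ := by
    intro x
    obtain ⟨μ, ⟨h1, h2⟩, h3⟩ := (hK _ (hA x).1).2.2
    exact ⟨μ, h1, h2, fun ν hν hν' => h3 ν ⟨hν, hν'⟩⟩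
  choose Φ hinv hfull huniq using hμ
  have hcl : ∀ x, IsClosed (A x) := fun x => (hK _ (hA x).1).1
  have hAi : ∀ x, IsInvariantSet T (A x) := fun x => (hK _ (hA x).1).2.1
  have hsub : ∀ x, msupp (Φ x) ⊆ A x := fun x => msupp_sub _ (hcl x) (hfull x)
  have hAeq : ∀ y, ∀ x ∈ A y, A y = A x := fun y x hx => hAu x _ ⟨(hA y).1, hx⟩
  have hΦeq : ∀ y, ∀ x ∈ A y, Φ x = Φ y := by
    intro y x hx
    apply huniq y _ (hinv x)
    rw [hAeq y x hx]
    exact hfull x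
  have hmono : ∀ x (B : Set X) (ν : ProbabilityMeasure X), B ⊆ A x → ν.toMeasure B = 1 →
      ν.toMeasure (A x) = 1 := by
    intro x B ν hB h
    exact le_antisymm prob_le_one (h ▸ measure_mono hB)
  have hmin : ∀ x (K' : Set X), K' ⊆ A x → K'.Nonempty → IsClosed K' → IsInvariantSet T K' →
      msupp (Φ x) ⊆ K' := by
    rintro x K' hs ⟨z, hz⟩ hc hi
    obtain ⟨φ, ν, -, hν, h1, -⟩ := exists_inv_on T hi hc z hz id tendsto_id
    have : ν = Φ x := huniq x ν hν (hmono x _ ν hs h1)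
    rw [← this]
    exact msupp_sub ν hc h1
  refine ⟨Φ, fun x => ergodic_of_ue T (hcl x) _ (hinv x) (hfull x) (huniq x),
    fun x => generic_of_ue T (hAi x) (hcl x) _ (huniq x) x (hA x).2,
    fun y x hx => hΦeq y x (hsub y hx), fun x => ?_, ?_, ?_⟩
  · refine ⟨msupp_ne _, msupp_closed _, msupp_inv T _ (hinv x), fun K' hs hne hc hi => ?_⟩
    exact hs.antisymm (hmin x K' (hs.trans (hsub x)) hne hc hi)
  · rintro K x ⟨hne, hc, hi, hm⟩ hx
    have hKA : K ∩ A x = K := by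
      refine hm _ Set.inter_subset_left ⟨x, hx, (hA x).2⟩ (hc.inter (hcl x)) ?_
      unfold IsInvariantSet
      rw [Set.image_inter T.injective, hi, hAi x]
    have h1 : msupp (Φ x) ⊆ K :=
      hmin x K (Set.inter_eq_left.1 hKA) hne hc hi
    exact (hm _ h1 (msupp_ne _) (msupp_closed _) (msupp_inv T _ (hinv x))).symm
  · intro y ν hν h1
    exact huniq y ν hν (hmono y _ ν (hsub y) h1)

/-- Lower semicontinuity of the support: uniform version. -/
lemma supp_lsc (μ : ProbabilityMeasure X) (ν : ℕ → ProbabilityMeasure X)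
    (h : Tendsto ν atTop (𝓝 μ)) (ε : ℝ) (hε : 0 < ε) :
    ∀ᶠ n in atTop, ∀ x ∈ msupp μ, ∃ y ∈ msupp (ν n), dist x y ≤ ε := by
  have hcpt : IsCompact (msupp μ) := (msupp_closed μ).isCompact
  obtain ⟨t, ht, htf, hcov⟩ := hcpt.finite_cover_balls (half_pos hε)
  have hev : ∀ x ∈ t, ∀ᶠ n in atTop, (msupp (ν n) ∩ ball x (ε / 2)).Nonempty := by
    intro x hx
    have hpos := ht hx (ball x (ε / 2)) isOpen_ball (mem_ball_self (half_pos hε))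
    have hlim := ProbabilityMeasure.le_liminf_measure_open_of_tendsto h
      (isOpen_ball (x := x) (ε := ε / 2))
    have := eventually_lt_of_lt_liminf (hpos.trans_le hlim)
    filter_upwards [this] with n hn
    by_contra hempty
    rw [Set.not_nonempty_iff_eq_empty] at hempty
    have hsub : ball x (ε / 2) ⊆ (msupp (ν n))ᶜ := by
      intro z hz hz'
      have : z ∈ (∅ : Set X) := hempty ▸ ⟨hz', hz⟩
      exact this
    have h0 := (prob_compl_eq_zero_iff (μ := (ν n).toMeasure)
      (msupp_closed (ν n)).measurableSet).2 (msupp_full _)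
    exact absurd (measure_mono_null hsub h0) hn.ne'
  have hall := (Filter.eventually_all_finite htf).2 hev
  filter_upwards [hall] with n hn x hx
  obtain ⟨c, hc, hxc⟩ := Set.mem_iUnion₂.1 (hcov hx)
  obtain ⟨y, hy, hyc⟩ := hn c hc
  refine ⟨y, hy, ?_⟩
  have h1 : dist x c < ε / 2 := hxc
  have h2 : dist y c < ε / 2 := hyc
  have := dist_triangle_right x y c
  linarith

lemma forward_dir (T : X ≃ₜ X) (Φ : X → ProbabilityMeasure X) (M : Set X)
    (herg : ∀ x, IsErgodicMeasure T (Φ x)) (hgen : ∀ x, IsGenericFor T x (Φ x))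
    (heq : ∀ y, ∀ x ∈ msupp (Φ y), Φ x = Φ y)
    (hM : ∀ x, x ∈ M ↔ x ∈ msupp (Φ x))
    (hc : IsClosed M) (hu : UniformOn T M) :
    IsCompact (ErgodicSet T) ∧ SuppContinuousOnErgodic T := by
  have hcont : ContinuousOn Φ M := by
    intro x hx
    refine pm_tendsto.2 fun f => ?_
    obtain ⟨g, hg⟩ := hu f
    have hgc : ContinuousOn g M :=
      hg.continuousOn (Eventually.of_forall fun n => (cesaro_cont T f n).continuousOn).frequently
    have hgeq : ∀ z ∈ M, g z = ∫ y, f y ∂(Φ z).toMeasure := fun z hz =>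
      tendsto_nhds_unique (hg.tendsto_at hz) (hgen z f)
    rw [← hgeq x hx]
    refine (hgc x hx).congr' ?_
    filter_upwards [self_mem_nhdsWithin] with z hz
    exact hgeq z hz
  have hmemM : ∀ y, ∀ x ∈ msupp (Φ y), x ∈ M := by
    intro y x hx
    rw [hM, heq y x hx]; exact hx
  have himg : ErgodicSet T = Φ '' M := by
    ext μ
    constructor
    · intro hμ
      obtain ⟨y, rfl⟩ := ergodic_surj T Φ hgen μ hμ
      obtain ⟨x, hx⟩ := msupp_ne (Φ y)
      exact ⟨x, hmemM y x hx, heq y x hx⟩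
    · rintro ⟨x, -, rfl⟩
      exact herg x
  refine ⟨himg ▸ hc.isCompact.image_of_continuousOn hcont, ?_⟩
  intro μ hμ ν hν hlim
  have husc : ∀ ε > 0, ∀ᶠ n in atTop, ∀ x ∈ msupp (ν n), infDist x (msupp μ) ≤ ε := by
    intro ε hε
    by_contra hcon
    rw [not_eventually] at hcon
    obtain ⟨φ, hφ, hb⟩ := extraction_of_frequently_atTop hcon
    push Not at hb
    choose x hx hxe using hb
    have hxM : ∀ k, x k ∈ M ∧ Φ (x k) = ν (φ k) := by
      intro k
      obtain ⟨y, hy⟩ := ergodic_surj T Φ hgen _ (hν (φ k))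
      have hxk := hx k
      rw [← hy] at hxk ⊢
      exact ⟨hmemM _ _ hxk, heq _ _ hxk⟩
    obtain ⟨z, hz, ψ, hψ, hxz⟩ := hc.isCompact.tendsto_subseq fun k => (hxM k).1
    have h1 : Tendsto (fun k => Φ (x (ψ k))) atTop (𝓝 (Φ z)) := by
      refine (hcont z hz).tendsto.comp (tendsto_nhdsWithin_iff.2 ⟨hxz, ?_⟩)
      exact Eventually.of_forall fun k => (hxM _).1
    have h2 : Tendsto (fun k => Φ (x (ψ k))) atTop (𝓝 μ) := by
      refine (hlim.comp (hφ.tendsto_atTop.comp hψ.tendsto_atTop)).congr fun k => ?_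
      exact (hxM (ψ k)).2.symm
    have h3 : Φ z = μ := tendsto_nhds_unique h1 h2
    have h4 : z ∈ msupp μ := h3 ▸ (hM z).1 hz
    have h5 : Tendsto (fun k => infDist (x (ψ k)) (msupp μ)) atTop (𝓝 (infDist z (msupp μ))) :=
      ((continuous_infDist_pt (msupp μ)).tendsto z).comp hxz
    have h6 := ge_of_tendsto' h5 fun k => (hxe (ψ k)).le
    rw [infDist_zero_of_mem h4] at h6
    linarith
  rw [Metric.tendsto_atTop']
  intro ε hε
  have h1 := husc (ε / 2) (half_pos hε)
  have h2 := supp_lsc μ ν hlim (ε / 2) (half_pos hε)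
  obtain ⟨N, hN⟩ := eventually_atTop.1 (h1.and h2)
  refine ⟨N, fun n hn => ?_⟩
  obtain ⟨ha, hb⟩ := hN n hn.le
  rw [Real.dist_eq, sub_zero, abs_of_nonneg hausdorffDist_nonneg]
  refine (hausdorffDist_le_of_infDist (half_pos hε).le ha fun x hx => ?_).trans_lt (half_lt_self hε)
  obtain ⟨y, hy, hd⟩ := hb x hx
  exact (infDist_le_dist_of_mem hy).trans hd

lemma infDist_le_hd (μ ν : ProbabilityMeasure X) {x : X} (hx : x ∈ msupp ν) :
    infDist x (msupp μ) ≤ hausdorffDist (msupp ν) (msupp μ) :=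
  infDist_le_hausdorffDist_of_mem hx (hausdorffEDist_ne_top_of_nonempty_of_bounded
    (msupp_ne _) (msupp_ne _) (msupp_closed ν).isCompact.isBounded
    (msupp_closed μ).isCompact.isBounded)

lemma backward_dir (T : X ≃ₜ X) (Φ : X → ProbabilityMeasure X) (M : Set X)
    (herg : ∀ x, IsErgodicMeasure T (Φ x)) (hgen : ∀ x, IsGenericFor T x (Φ x))
    (heq : ∀ y, ∀ x ∈ msupp (Φ y), Φ x = Φ y)
    (huniq : ∀ y (ν : ProbabilityMeasure X), IsInvariantMeasure T ν →
        ν.toMeasure (msupp (Φ y)) = 1 → ν = Φ y)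
    (hM : ∀ x, x ∈ M ↔ x ∈ msupp (Φ x))
    (hc : IsCompact (ErgodicSet T)) (hs : SuppContinuousOnErgodic T) :
    IsClosed M ∧ UniformOn T M := by
  constructor
  · rw [← isSeqClosed_iff_isClosed]
    intro x z hx hxz
    obtain ⟨μ, hμ, φ, hφ, hlim⟩ := hc.tendsto_subseq fun k => herg (x k)
    have h1 := hs μ hμ (fun k => Φ (x (φ k))) (fun k => herg _) hlim
    have h2 : Tendsto (fun k => infDist (x (φ k)) (msupp μ)) atTop (𝓝 (infDist z (msupp μ))) :=
      ((continuous_infDist_pt (msupp μ)).tendsto z).comp (hxz.comp hφ.tendsto_atTop)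
    have h3 : infDist z (msupp μ) ≤ 0 :=
      le_of_tendsto_of_tendsto' h2 h1 fun k => infDist_le_hd _ _ ((hM _).1 (hx (φ k)))
    have h4 : z ∈ msupp μ := ((msupp_closed μ).mem_iff_infDist_zero (msupp_ne μ)).2
      (le_antisymm h3 infDist_nonneg)
    obtain ⟨y, rfl⟩ := ergodic_surj T Φ hgen μ hμ
    rw [hM, heq y z h4]
    exact h4
  · intro f
    refine ⟨fun x => ∫ y, f y ∂(Φ x).toMeasure, ?_⟩
    rw [Metric.tendstoUniformlyOn_iff]
    intro ε hε
    by_contra hcon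
    rw [not_eventually] at hcon
    obtain ⟨n, hn, hb⟩ := extraction_of_frequently_atTop hcon
    push Not at hb
    choose x hx hxe using hb
    obtain ⟨μ, hμ, φ, hφ, hlim⟩ := hc.tendsto_subseq fun k => herg (x k)
    obtain ⟨ψ, ν, hψ, hinv, hl⟩ := krylov T (fun k => x (φ k)) (fun k => n (φ k))
      (hn.tendsto_atTop.comp hφ.tendsto_atTop)
    have hlim2 : Tendsto (fun k => Φ (x (φ (ψ k)))) atTop (𝓝 μ) := hlim.comp hψ.tendsto_atTop
    have h1 := hs μ hμ (fun k => Φ (x (φ (ψ k)))) (fun k => herg _) hlim2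
    have hfull : ν.toMeasure (msupp μ) = 1 := by
      refine krylov_supp T (fun k => x (φ (ψ k))) (fun k => n (φ (ψ k))) _ ν h1
        (fun k => hausdorffDist_nonneg) _ (msupp_closed μ) (msupp_ne μ) (fun k i => ?_) hl
      exact infDist_le_hd _ _ (iter_mem T (msupp_inv T _ (ergodic_inv (herg _)))
        ((hM _).1 (hx _)) i)
    have hνμ : ν = μ := by
      obtain ⟨y, rfl⟩ := ergodic_surj T Φ hgen μ hμ
      exact huniq y ν hinv hfull
    subst hνμ
    have h2 := (pm_tendsto.1 hlim2 f).dist (hl f)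
    rw [dist_self] at h2
    have := ge_of_tendsto' h2 fun k => hxe (φ (ψ k))
    linarith

end Helpers
/-- for a partitionable system, the union `M` of all minimal sets is closed
and the subsystem `(M,T)` is strictly uniform iff `ℳ_T^e(X)` is compact and
`supp : ℳ_T^e(X) → 2^X` is continuous. -/
theorem stmt_14 {X : Type*} [MetricSpace X] [CompactSpace X]
    [MeasurableSpace X] [BorelSpace X] (T : X ≃ₜ X)
    (hp : Partitionable T)
    (M : Set X) (hM : M = ⋃₀ {K : Set X | IsMinimalSet T K}) :
    (IsClosed M ∧ UniformOn T M ∧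
        ∀ x ∈ M, ∃ K : Set X, K ⊆ M ∧ IsMinimalSet T K ∧ x ∈ K) ↔
      IsCompact (ErgodicSet T) ∧ SuppContinuousOnErgodic T := by
  obtain ⟨Φ, herg, hgen, heq, hmin, hK, huniq⟩ := partition_data T hp
  have hMm : ∀ x, x ∈ M ↔ x ∈ msupp (Φ x) := by
    intro x
    rw [hM]
    constructor
    · rintro ⟨K, hKm, hx⟩
      rw [← hK K x hKm hx]
      exact hx
    · intro hx
      exact ⟨_, hmin x, hx⟩
  constructor
  · rintro ⟨hc, hu, -⟩
    exact forward_dir T Φ M herg hgen heq hMm hc hu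
  · rintro ⟨hc, hs⟩
    obtain ⟨h1, h2⟩ := backward_dir T Φ M herg hgen heq huniq hMm hc hs
    refine ⟨h1, h2, fun x hx => ⟨msupp (Φ x), fun z hz => ?_, hmin x, (hMm x).1 hx⟩⟩
    rw [hMm, heq x z hz]
    exact hz
end
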